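/- Fix a real number p ≥ 1 and n ≥ 1. The function φ on [1,∞)^n defined by φ(u) = Σ_{i=1}^n ((u_i + √(u_i² − 1))^p + (u_i − √(u_i² − 1))^p) is Schur-convex: whenever v, u ∈ [1,∞)^n and v is majorized by u, one has φ(v) ≤ φ(u). -/

import Mathlib

/-- The sum of the `k` largest entries of `x`, expressed as the supremum of the
sums of `x` over all subsets of cardinality `k`. -/
noncomputable def kLargestSum {n : ℕ} (x : Fin n → ℝ) (k : ℕ) : ℝ :=
  sSup {y : ℝ | ∃ s : Finset (Fin n), s.card = k ∧ y = ∑ i ∈ s, x i}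

/-- `v` is majorized by `u`. -/
def IsMajorizedBy {n : ℕ} (v u : Fin n → ℝ) : Prop :=
  (∀ k : ℕ, 1 ≤ k → k ≤ n - 1 → kLargestSum v k ≤ kLargestSum u k) ∧
  ∑ i, v i = ∑ i, u i

/-- The function `φ(u) = Σᵢ ((uᵢ + √(uᵢ² − 1))^p + (uᵢ − √(uᵢ² − 1))^p)`. -/
noncomputable def phi {n : ℕ} (p : ℝ) (u : Fin n → ℝ) : ℝ :=
  ∑ i, ((u i + Real.sqrt ((u i) ^ 2 - 1)) ^ p + (u i - Real.sqrt ((u i) ^ 2 - 1)) ^ p)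

open Finset in
/-- A nonnegativity criterion by summation by parts: an antitone weight paired with a sequence
whose partial sums are nonnegative dominates its last weight times the total sum. -/
theorem Antitone.mul_sum_range_le_sum_range_mul {c d : ℕ → ℝ} (hc : Antitone c) (m : ℕ)
    (hd : ∀ k, 1 ≤ k → k ≤ m → 0 ≤ ∑ i ∈ range k, d i) :
    c m * ∑ i ∈ range (m + 1), d i ≤ ∑ i ∈ range (m + 1), c i * d i := by
  induction m with
  | zero => simp
  | succ m ih =>
    rw [sum_range_succ, sum_range_succ (fun i => c i * d i), mul_add]
    have h₁ := ih fun k hk hkm => hd k hk (hkm.trans m.le_succ)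
    have h₂ := mul_le_mul_of_nonneg_right (hc m.le_succ) (hd (m + 1) (by lia) le_rfl)
    linarith

section Rearrangement

variable {m : ℕ}

/-- The decreasing rearrangement of `x`, extended to `ℕ` by repeating its smallest entry. -/
noncomputable def decreasingRearrangement (x : Fin (m + 1) → ℝ) (i : ℕ) : ℝ :=
  x (Tuple.sort (fun j => -x j) (Fin.clamp i m))

theorem decreasingRearrangement_antitone (x : Fin (m + 1) → ℝ) :
    Antitone (decreasingRearrangement x) := fun _ _ hij =>
  neg_le_neg_iff.1 (Tuple.monotone_sort (fun j => -x j) (Fin.clamp_monotone hij))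

theorem decreasingRearrangement_mem {s : Set ℝ} {x : Fin (m + 1) → ℝ} (hx : ∀ i, x i ∈ s)
    (i : ℕ) : decreasingRearrangement x i ∈ s :=
  hx _

theorem sum_range_decreasingRearrangement (f : ℝ → ℝ) (x : Fin (m + 1) → ℝ) :
    ∑ i ∈ Finset.range (m + 1), f (decreasingRearrangement x i) = ∑ i, f (x i) := by
  rw [← Fin.sum_univ_eq_sum_range (fun i => f (decreasingRearrangement x i)),
    ← Equiv.sum_comp (Tuple.sort fun j => -x j) (fun i => f (x i))]
  refine Finset.sum_congr rfl fun i _ => ?_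
  have : Fin.clamp i m = i := Fin.ext (by simp; lia)
  rw [decreasingRearrangement, this]

theorem sum_range_decreasingRearrangement_le_kLargestSum (x : Fin (m + 1) → ℝ) {k : ℕ}
    (hk : k ≤ m + 1) :
    ∑ i ∈ Finset.range k, decreasingRearrangement x i ≤ kLargestSum x k := by
  have hbdd : BddAbove {y : ℝ | ∃ s : Finset (Fin (m + 1)), s.card = k ∧ y = ∑ i ∈ s, x i} :=
    ((Set.finite_range fun s : Finset (Fin (m + 1)) => ∑ i ∈ s, x i).subset
      (by rintro _ ⟨s, -, rfl⟩; exact ⟨s, rfl⟩)).bddAbove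
  have hinj : Set.InjOn (fun i => Tuple.sort (fun j => -x j) (Fin.clamp i m))
      (Finset.range k) := by
    intro i hi j hj hij
    simp only [Finset.coe_range, Set.mem_Iio] at hi hj
    have := congrArg Fin.val ((Tuple.sort fun j => -x j).injective hij)
    simp only [Fin.coe_clamp] at this
    lia
  refine le_csSup hbdd ⟨(Finset.range k).image
    fun i => Tuple.sort (fun j => -x j) (Fin.clamp i m), ?_, ?_⟩
  · rw [Finset.card_image_of_injOn hinj, Finset.card_range]
  · rw [Finset.sum_image hinj]
    rfl

theorem kLargestSum_le_sum_range_decreasingRearrangement (x : Fin (m + 1) → ℝ) {k : ℕ}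
    (hk : 1 ≤ k) (hkm : k ≤ m + 1) :
    kLargestSum x k ≤ ∑ i ∈ Finset.range k, decreasingRearrangement x i := by
  obtain ⟨s₀, -, hs₀⟩ := Finset.exists_subset_card_eq
    (s := (Finset.univ : Finset (Fin (m + 1)))) (by simpa using hkm)
  refine csSup_le ⟨_, s₀, hs₀, rfl⟩ ?_
  rintro _ ⟨s, hs, rfl⟩
  set w := decreasingRearrangement x
  set t := w (k - 1)
  have hw : Antitone w := decreasingRearrangement_antitone x
  have key : ∑ i ∈ s, (x i - t) ≤ ∑ i ∈ Finset.range k, (w i - t) := calc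
    ∑ i ∈ s, (x i - t) ≤ ∑ i ∈ s, max (x i - t) 0 :=
      Finset.sum_le_sum fun i _ => le_max_left _ _
    _ ≤ ∑ i, max (x i - t) 0 :=
      Finset.sum_le_univ_sum_of_nonneg fun i => le_max_right _ _
    _ = ∑ i ∈ Finset.range (m + 1), max (w i - t) 0 :=
      (sum_range_decreasingRearrangement (fun y => max (y - t) 0) x).symm
    _ = ∑ i ∈ Finset.range k, max (w i - t) 0 := by
      refine (Finset.sum_subset (Finset.range_mono hkm) fun i _ hi => ?_).symm
      rw [Finset.mem_range, not_lt] at hi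
      exact max_eq_right (sub_nonpos.2 (hw (by lia)))
    _ = ∑ i ∈ Finset.range k, (w i - t) := by
      refine Finset.sum_congr rfl fun i hi => max_eq_left (sub_nonneg.2 (hw ?_))
      rw [Finset.mem_range] at hi
      lia
  simpa [Finset.sum_sub_distrib, hs] using key

end Rearrangement

/-- **Karamata's inequality**, for a function with a monotone choice of subgradients. -/
theorem IsMajorizedBy.sum_le_sum {n : ℕ} {u v : Fin n → ℝ} (h : IsMajorizedBy v u)
    {s : Set ℝ} (hu : ∀ i, u i ∈ s) (hv : ∀ i, v i ∈ s) {f g : ℝ → ℝ} (hg : MonotoneOn g s)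
    (hfg : ∀ x ∈ s, ∀ y ∈ s, g x * (y - x) ≤ f y - f x) :
    ∑ i, f (v i) ≤ ∑ i, f (u i) := by
  obtain _ | m := n
  · simp
  set a := decreasingRearrangement u
  set b := decreasingRearrangement v
  have ha : ∀ i, a i ∈ s := decreasingRearrangement_mem hu
  have hb : ∀ i, b i ∈ s := decreasingRearrangement_mem hv
  have hc : Antitone fun i => g (b i) := fun i j hij =>
    hg (hb j) (hb i) (decreasingRearrangement_antitone v hij)
  have hparts := hc.mul_sum_range_le_sum_range_mul (d := fun i => a i - b i) m fun k hk hkm => by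
    rw [Finset.sum_sub_distrib, sub_nonneg]
    calc ∑ i ∈ Finset.range k, b i ≤ kLargestSum v k :=
          sum_range_decreasingRearrangement_le_kLargestSum v (by lia)
      _ ≤ kLargestSum u k := h.1 k hk (by lia)
      _ ≤ ∑ i ∈ Finset.range k, a i :=
          kLargestSum_le_sum_range_decreasingRearrangement u hk (by lia)
  have htotal : ∑ i ∈ Finset.range (m + 1), (a i - b i) = 0 := by
    rw [Finset.sum_sub_distrib, sub_eq_zero]
    exact (sum_range_decreasingRearrangement id u).trans
      (h.2.symm.trans (sum_range_decreasingRearrangement id v).symm)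
  have hsub : ∑ i ∈ Finset.range (m + 1), g (b i) * (a i - b i) ≤
      ∑ i ∈ Finset.range (m + 1), (f (a i) - f (b i)) :=
    Finset.sum_le_sum fun i _ => hfg _ (hb i) _ (ha i)
  rw [Finset.sum_sub_distrib, sum_range_decreasingRearrangement f u,
    sum_range_decreasingRearrangement f v] at hsub
  rw [htotal, mul_zero] at hparts
  linarith

section Hyperbolic

open Real Set

variable {p : ℝ}

theorem hasDerivAt_cosh_const_mul (p t : ℝ) :
    HasDerivAt (fun t => cosh (p * t)) (p * sinh (p * t)) t := by
  simpa [mul_comm] using ((hasDerivAt_id t).const_mul p).cosh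

theorem hasDerivAt_sinh_const_mul (p t : ℝ) :
    HasDerivAt (fun t => sinh (p * t)) (p * cosh (p * t)) t := by
  simpa [mul_comm] using ((hasDerivAt_id t).const_mul p).sinh

theorem monotoneOn_Ici_of_hasDerivAt_nonneg {f f' : ℝ → ℝ} (hf : ∀ t, HasDerivAt f (f' t) t)
    (hf' : ∀ t, 0 < t → 0 ≤ f' t) : MonotoneOn f (Ici 0) :=
  monotoneOn_of_deriv_nonneg (convex_Ici 0)
    (fun t _ => (hf t).continuousAt.continuousWithinAt)
    (fun t _ => (hf t).differentiableAt.differentiableWithinAt)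
    fun t ht => (hf t).deriv ▸ hf' t (by simpa using ht)

theorem mul_sinh_le_sinh_mul (hp : 1 ≤ p) {t : ℝ} (ht : 0 ≤ t) :
    p * sinh t ≤ sinh (p * t) := by
  have hmono := monotoneOn_Ici_of_hasDerivAt_nonneg
    (fun t => (hasDerivAt_sinh_const_mul p t).sub ((hasDerivAt_sinh t).const_mul p))
    fun t ht => by
      rw [← mul_sub]
      refine mul_nonneg (by linarith) (sub_nonneg.2 (cosh_le_cosh.2 ?_))
      exact abs_le_abs_of_nonneg ht.le (le_mul_of_one_le_left ht.le hp)
  simpa using hmono self_mem_Ici ht ht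

theorem sinh_mul_mul_cosh_le (hp : 1 ≤ p) {t : ℝ} (ht : 0 ≤ t) :
    sinh (p * t) * cosh t ≤ p * cosh (p * t) * sinh t := by
  have hmono := monotoneOn_Ici_of_hasDerivAt_nonneg
    (f' := fun t => (p ^ 2 - 1) * (sinh (p * t) * sinh t))
    (fun t => ((((hasDerivAt_cosh_const_mul p t).const_mul p).mul (hasDerivAt_sinh t)).sub
      ((hasDerivAt_sinh_const_mul p t).mul (hasDerivAt_cosh t))).congr_deriv (by ring))
    fun t ht => by
      have h₁ : 0 ≤ sinh (p * t) := sinh_nonneg_iff.2 (by positivity)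
      have h₂ : 0 ≤ sinh t := sinh_nonneg_iff.2 ht.le
      exact mul_nonneg (by nlinarith) (mul_nonneg h₁ h₂)
  simpa using hmono self_mem_Ici ht ht

/-- The derivative of `cosh (p * t)` with respect to `cosh t`, for `0 ≤ t`. -/
noncomputable def coshSlope (p t : ℝ) : ℝ :=
  if t = 0 then p ^ 2 else p * sinh (p * t) / sinh t

theorem coshSlope_monotoneOn (hp : 1 ≤ p) : MonotoneOn (coshSlope p) (Ici 0) := by
  have hpos : MonotoneOn (fun t => p * sinh (p * t) / sinh t) (Ioi 0) := by
    have hderiv : ∀ t ∈ Ioi (0 : ℝ), HasDerivAt (fun t => p * sinh (p * t) / sinh t) _ t :=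
      fun t ht => ((hasDerivAt_sinh_const_mul p t).const_mul p).div (hasDerivAt_sinh t)
        (sinh_pos_iff.2 ht).ne'
    refine monotoneOn_of_deriv_nonneg (convex_Ioi 0)
      (fun t ht => (hderiv t ht).continuousAt.continuousWithinAt)
      (fun t ht => (hderiv t (interior_subset ht)).differentiableAt.differentiableWithinAt)
      fun t ht => ?_
    rw [interior_Ioi] at ht
    rw [(hderiv t ht).deriv]
    refine div_nonneg ?_ (sq_nonneg _)
    nlinarith [sinh_mul_mul_cosh_le hp (mem_Ioi.1 ht).le]
  intro s hs t ht hst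
  obtain rfl | hs := eq_or_lt_of_le (mem_Ici.1 hs)
  · obtain rfl | ht := eq_or_lt_of_le (mem_Ici.1 ht)
    · rfl
    · simp only [coshSlope, if_true, ht.ne', if_false]
      rw [le_div_iff₀ (sinh_pos_iff.2 ht)]
      nlinarith [mul_sinh_le_sinh_mul hp ht.le]
  · have ht := hs.trans_le hst
    simpa only [coshSlope, hs.ne', ht.ne', if_false] using hpos hs ht hst

theorem exists_coshSlope_mul_eq (p : ℝ) {s t : ℝ} (hs : 0 ≤ s) (hst : s < t) :
    ∃ r ∈ Ioo s t, cosh (p * t) - cosh (p * s) = coshSlope p r * (cosh t - cosh s) := by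
  obtain ⟨r, hr, h⟩ := exists_ratio_hasDerivAt_eq_ratio_slope
    (fun t => cosh (p * t)) (fun t => p * sinh (p * t)) hst (by fun_prop)
    (fun t _ => hasDerivAt_cosh_const_mul p t) cosh sinh (by fun_prop)
    (fun t _ => hasDerivAt_cosh t)
  have hr₀ : 0 < r := hs.trans_lt hr.1
  refine ⟨r, hr, ?_⟩
  have := (sinh_pos_iff.2 hr₀).ne'
  rw [coshSlope, if_neg hr₀.ne']
  field_simp
  linarith

theorem coshSlope_mul_le (hp : 1 ≤ p) {s t : ℝ} (hs : 0 ≤ s) (ht : 0 ≤ t) :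
    coshSlope p s * (cosh t - cosh s) ≤ cosh (p * t) - cosh (p * s) := by
  obtain hst | rfl | hst := lt_trichotomy s t
  · obtain ⟨r, hr, h⟩ := exists_coshSlope_mul_eq p hs hst
    have hslope := coshSlope_monotoneOn hp hs (hs.trans hr.1.le) hr.1.le
    have hcosh : cosh s ≤ cosh t := cosh_le_cosh.2 (abs_le_abs_of_nonneg hs hst.le)
    nlinarith
  · simp
  · obtain ⟨r, hr, h⟩ := exists_coshSlope_mul_eq p ht hst
    have hslope := coshSlope_monotoneOn hp (ht.trans hr.1.le) hs hr.2.le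
    have hcosh : cosh t ≤ cosh s := cosh_le_cosh.2 (abs_le_abs_of_nonneg ht hst.le)
    nlinarith

theorem add_sqrt_rpow_add_sub_sqrt_rpow (p : ℝ) {x : ℝ} (hx : 1 ≤ x) :
    (x + √(x ^ 2 - 1)) ^ p + (x - √(x ^ 2 - 1)) ^ p = 2 * cosh (p * arcosh x) := by
  rw [← add_sqrt_self_sq_sub_one_inv hx, ← exp_arcosh hx, ← exp_neg, ← exp_mul, ← exp_mul,
    cosh_eq]
  ring_nf

end Hyperbolic

theorem phi_schur_convex (p : ℝ) (hp : 1 ≤ p) (n : ℕ) (hn : 1 ≤ n)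
    (u v : Fin n → ℝ) (hu : ∀ i, u i ∈ Set.Ici (1 : ℝ)) (hv : ∀ i, v i ∈ Set.Ici (1 : ℝ))
    (hmaj : IsMajorizedBy v u) :
    phi p v ≤ phi p u := by
  simp only [phi, fun i => add_sqrt_rpow_add_sub_sqrt_rpow p (hu i),
    fun i => add_sqrt_rpow_add_sub_sqrt_rpow p (hv i), ← Finset.mul_sum]
  refine mul_le_mul_of_nonneg_left (hmaj.sum_le_sum hu hv
    (f := fun x => Real.cosh (p * Real.arcosh x)) (g := fun x => coshSlope p (Real.arcosh x))
    ?_ ?_) zero_le_two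
  · intro x hx y hy hxy
    rw [Set.mem_Ici] at hx hy
    exact coshSlope_monotoneOn hp (Real.arcosh_nonneg hx) (Real.arcosh_nonneg hy)
      ((Real.arcosh_le_arcosh (by linarith) (by linarith)).2 hxy)
  · intro x hx y hy
    simpa only [Real.cosh_arcosh hx, Real.cosh_arcosh hy] using
      coshSlope_mul_le hp (Real.arcosh_nonneg hx) (Real.arcosh_nonneg hy)
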